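/- Let n ≥ 1, let Q ⊂ ℝⁿ be compact, let u : ℝⁿ → ℝ be Lipschitz, and let ρ : ℝⁿ → [0,∞) be a Borel function such that ∫_{Q ∩ u⁻¹(t)} ρ dH^{n−1} ≥ 1 for almost every t ∈ (0,1). Then ∫_Q ρ(x) ‖∇u(x)‖ dH^n(x) ≥ 1, where ∇u denotes the gradient of u, which exists H^n-almost everywhere by Rademacher's theorem. -/

import Mathlib

open MeasureTheory

/-- The standard (normalized) `d`-dimensional Hausdorff measure: Mathlib's (unnormalized)
Hausdorff measure multiplied by the isodiametric normalization constant `ω_d / 2^d`, where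
`ω_d` is the volume of the Euclidean unit `d`-ball. With this normalization the
`n`-dimensional Hausdorff measure on `ℝⁿ` equals Lebesgue measure. -/
noncomputable def stdHausdorff (d : ℕ) (X : Type*) [EMetricSpace X] [MeasurableSpace X]
    [BorelSpace X] : Measure X :=
  (volume (Metric.ball (0 : EuclideanSpace ℝ (Fin d)) 1) / 2 ^ d) • μH[(d : ℝ)]

/-- One-dimensional Brunn-Minkowski inequality. -/
theorem Real.volume_add_volume_le_of_add_mem {A B C : Set ℝ} (hA : MeasurableSet A)
    (hB : MeasurableSet B) (hA₀ : A.Nonempty) (hB₀ : B.Nonempty)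
    (hC : ∀ x ∈ A, ∀ y ∈ B, x + y ∈ C) : volume A + volume B ≤ volume C := by
  have compact_case : ∀ K L : Set ℝ, IsCompact K → IsCompact L → K.Nonempty → L.Nonempty →
      K ⊆ A → L ⊆ B → volume K + volume L ≤ volume C := by
    intro K L hK hL hK₀ hL₀ hKA hLB
    have ha := hK.sSup_mem hK₀
    have hb := hL.sInf_mem hL₀
    set a := sSup K
    set b := sInf L
    have h₁ : volume ((fun x => b + x) '' K) = volume K := by simp
    have h₂ : volume ((fun x => a + x) '' L) = volume L := by simp
    rw [← h₁, ← h₂, ← measure_union₀ ((hL.image (by fun_prop)).measurableSet.nullMeasurableSet)]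
    · refine measure_mono (Set.union_subset ?_ ?_)
      · rintro _ ⟨x, hx, rfl⟩
        simpa [add_comm] using hC x (hKA hx) b (hLB hb)
      · rintro _ ⟨x, hx, rfl⟩
        exact hC a (hKA ha) x (hLB hx)
    · refine measure_mono_null (t := {a + b}) ?_ (by simp)
      rintro _ ⟨⟨x, hx, rfl⟩, y, hy, hxy⟩
      have h₃ : x ≤ a := le_csSup hK.bddAbove hx
      have h₄ : b ≤ y := csInf_le hL.bddBelow hy
      simp only at hxy
      simp only [Set.mem_singleton_iff]
      linarith
  obtain ⟨a, ha⟩ := hA₀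
  obtain ⟨b, hb⟩ := hB₀
  rw [hA.measure_eq_iSup_isCompact, hB.measure_eq_iSup_isCompact]
  simp_rw [iSup_and']
  refine ENNReal.biSup_add_biSup_le' ⟨∅, by simp⟩ ⟨∅, by simp⟩ fun K hK L hL => ?_
  exact (add_le_add (measure_mono (Set.subset_insert a K)) (measure_mono
    (Set.subset_insert b L))).trans (compact_case _ _ (hK.2.insert a) (hL.2.insert b)
      (Set.insert_nonempty _ _) (Set.insert_nonempty _ _) (Set.insert_subset ha hK.1)
      (Set.insert_subset hb hL.1))

theorem lintegral_add_lintegral_le_of_mul_le_sq {f g h : ℝ → ℝ} (hf : Measurable f)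
    (hg : Measurable g) (hh : Measurable h) (hf₀ : ∀ x, 0 ≤ f x) (hg₀ : ∀ x, 0 ≤ g x)
    (hh₀ : ∀ x, 0 ≤ h x) (hf₁ : ∀ x, f x ≤ 1) (hg₁ : ∀ x, g x ≤ 1)
    (hf₂ : ∀ t < 1, ∃ x, t < f x) (hg₂ : ∀ t < 1, ∃ x, t < g x)
    (hfg : ∀ x y, f x * g y ≤ h ((2 : ℝ)⁻¹ • (x + y)) ^ 2) :
    (∫⁻ x, ENNReal.ofReal (f x)) + ∫⁻ x, ENNReal.ofReal (g x) ≤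
      2 * ∫⁻ x, ENNReal.ofReal (h x) := by
  rw [lintegral_eq_lintegral_meas_lt _ (.of_forall hf₀) hf.aemeasurable,
    lintegral_eq_lintegral_meas_lt _ (.of_forall hg₀) hg.aemeasurable,
    lintegral_eq_lintegral_meas_lt _ (.of_forall hh₀) hh.aemeasurable,
    ← lintegral_const_mul' _ _ (by simp), ← lintegral_add_left']
  · refine setLIntegral_mono' measurableSet_Ioi fun t ht => ?_
    obtain h1 | h1 := le_or_gt 1 t
    · have h2 : {x | t < f x} = ∅ := by ext x; simpa using (hf₁ x).trans h1
      have h3 : {x | t < g x} = ∅ := by ext x; simpa using (hg₁ x).trans h1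
      simp [h2, h3]
    · have h2 : volume ((fun x : ℝ => 2 * x) '' {x | t < h x}) = 2 * volume {x | t < h x} := by
        have := Measure.addHaar_image_linearMap volume ((2 : ℝ) • LinearMap.id (M := ℝ))
          {x | t < h x}
        simpa using this
      rw [← h2]
      refine Real.volume_add_volume_le_of_add_mem (measurableSet_lt measurable_const hf)
        (measurableSet_lt measurable_const hg) (hf₂ t h1) (hg₂ t h1) fun x hx y hy =>
          ⟨(2 : ℝ)⁻¹ • (x + y), ?_, by simp⟩
      simp only [Set.mem_ofPred_eq, Set.mem_Ioi] at *
      refine lt_of_pow_lt_pow_left₀ 2 (hh₀ _) (lt_of_lt_of_le ?_ (hfg x y))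
      nlinarith
  · have : Antitone fun t => volume {x | t < f x} := fun s t hst =>
      measure_mono fun x hx => lt_of_le_of_lt hst hx
    exact this.measurable.aemeasurable

theorem ENNReal.mul_le_sq_of_add_le_two_mul {a b c : ENNReal} (h : a + b ≤ 2 * c) :
    a * b ≤ c ^ 2 := by
  obtain rfl | hc := eq_or_ne c ⊤
  · simp
  have hab : a + b ≠ ⊤ := ne_top_of_le_ne_top (by finiteness) h
  lift c to NNReal using hc
  lift a to NNReal using (ENNReal.add_ne_top.1 hab).1
  lift b to NNReal using (ENNReal.add_ne_top.1 hab).2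
  norm_cast at *
  have h' : (a : ℝ) + b ≤ 2 * c := by exact_mod_cast h
  have : (a : ℝ) * b ≤ c ^ 2 := by
    nlinarith [sq_nonneg ((a : ℝ) - b), a.coe_nonneg, b.coe_nonneg, c.coe_nonneg]
  exact_mod_cast this

theorem ENNReal.inv_iSup_mul_le_one {ι : Type*} (φ : ι → ENNReal) (x : ι) :
    (⨆ y, φ y)⁻¹ * φ x ≤ 1 := by
  rw [mul_comm, ← div_eq_mul_inv]
  exact ENNReal.div_le_of_le_mul (by simpa using le_iSup φ x)

theorem ENNReal.exists_lt_toReal_inv_iSup_mul {ι : Type*} {φ : ι → ENNReal}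
    (h₀ : ⨆ y, φ y ≠ 0) (h₁ : ⨆ y, φ y ≠ ⊤) {t : ℝ} (ht : t < 1) :
    ∃ x, t < ((⨆ y, φ y)⁻¹ * φ x).toReal := by
  have h : ENNReal.ofReal t * ⨆ y, φ y < ⨆ y, φ y := by
    conv_rhs => rw [← one_mul (⨆ y, φ y)]
    exact (ENNReal.mul_lt_mul_iff_left h₀ h₁).2 (by simpa using ht)
  obtain ⟨x, hx⟩ := lt_iSup_iff.1 h
  refine ⟨x, ?_⟩
  by_contra! hle
  have h2 := ENNReal.ofReal_le_ofReal hle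
  rw [ENNReal.ofReal_toReal (ne_top_of_le_ne_top one_ne_top (inv_iSup_mul_le_one φ x)),
    mul_comm, ← div_eq_mul_inv, ENNReal.div_le_iff h₀ h₁] at h2
  exact absurd hx (not_lt.2 h2)

/-- The Prékopa-Leindler inequality for midpoints, as a property of a measured vector space. -/
def PrekopaLeindler (E : Type*) [AddCommGroup E] [Module ℝ E] [MeasureSpace E] : Prop :=
  ∀ f g h : E → ENNReal, Measurable f → Measurable g → Measurable h →
    (∀ x y, f x * g y ≤ h ((2 : ℝ)⁻¹ • (x + y)) ^ 2) →
    (∫⁻ x, f x) * ∫⁻ x, g x ≤ (∫⁻ x, h x) ^ 2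

theorem lintegral_mul_lintegral_le_sq_of_bounded {f g h : ℝ → ENNReal} (hf : Measurable f)
    (hg : Measurable g) (hh : Measurable h) {M : ENNReal} (hM : M ≠ ⊤) (hfM : ∀ x, f x ≤ M)
    (hgM : ∀ x, g x ≤ M) (hfg : ∀ x y, f x * g y ≤ h ((2 : ℝ)⁻¹ • (x + y)) ^ 2) :
    (∫⁻ x, f x) * ∫⁻ x, g x ≤ (∫⁻ x, h x) ^ 2 := by
  set a := ⨆ x, f x with ha
  set b := ⨆ x, g x with hb
  have haM : a ≠ ⊤ := ne_top_of_le_ne_top hM (iSup_le hfM)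
  have hbM : b ≠ ⊤ := ne_top_of_le_ne_top hM (iSup_le hgM)
  obtain ha0 | ha0 := eq_or_ne a 0
  · have : ∀ x, f x = 0 := fun x => le_zero_iff.1 (ha0 ▸ le_iSup f x)
    simp [this]
  obtain hb0 | hb0 := eq_or_ne b 0
  · have : ∀ x, g x = 0 := fun x => le_zero_iff.1 (hb0 ▸ le_iSup g x)
    simp [this]
  set c : ENNReal := (a * b) ^ (2⁻¹ : ℝ) with hc
  have hc2 : c ^ 2 = a * b := by
    rw [hc, ← ENNReal.rpow_natCast, ← ENNReal.rpow_mul]; simp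
  have hcM : c ≠ ⊤ := by rw [hc]; finiteness
  have hc0 : c ≠ 0 := by
    intro h; simp [h, ha0, hb0] at hc2
  have hfa : ∀ x, a⁻¹ * f x ≤ 1 := ENNReal.inv_iSup_mul_le_one f
  have hgb : ∀ x, b⁻¹ * g x ≤ 1 := ENNReal.inv_iSup_mul_le_one g
  have key := lintegral_add_lintegral_le_of_mul_le_sq (f := fun x => (a⁻¹ * f x).toReal)
    (g := fun x => (b⁻¹ * g x).toReal) (h := fun x => (min 1 (c⁻¹ * h x)).toReal)
    (by fun_prop) (by fun_prop) (by fun_prop) (fun _ => ENNReal.toReal_nonneg)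
    (fun _ => ENNReal.toReal_nonneg) (fun _ => ENNReal.toReal_nonneg)
    (fun x => ENNReal.toReal_le_of_le_ofReal one_pos.le (by simpa using hfa x))
    (fun x => ENNReal.toReal_le_of_le_ofReal one_pos.le (by simpa using hgb x)) ?_ ?_ ?_
  · simp only [ENNReal.ofReal_toReal (ne_top_of_le_ne_top ENNReal.one_ne_top (hfa _)),
      ENNReal.ofReal_toReal (ne_top_of_le_ne_top ENNReal.one_ne_top (hgb _)),
      ENNReal.ofReal_toReal (ne_top_of_le_ne_top ENNReal.one_ne_top (min_le_left _ _))] at key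
    have key2 := ENNReal.mul_le_sq_of_add_le_two_mul (key.trans (mul_le_mul_right
      (lintegral_mono fun x => min_le_right 1 (c⁻¹ * h x)) 2))
    rw [lintegral_const_mul _ hf, lintegral_const_mul _ hg, lintegral_const_mul _ hh] at key2
    calc (∫⁻ x, f x) * ∫⁻ x, g x
        = (a * b) * ((a⁻¹ * ∫⁻ x, f x) * (b⁻¹ * ∫⁻ x, g x)) := by
          rw [show (a * b) * ((a⁻¹ * ∫⁻ x, f x) * (b⁻¹ * ∫⁻ x, g x)) =
            (a * a⁻¹) * (b * b⁻¹) * ((∫⁻ x, f x) * ∫⁻ x, g x) by ring,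
            ENNReal.mul_inv_cancel ha0 haM, ENNReal.mul_inv_cancel hb0 hbM]; simp
      _ ≤ c ^ 2 * (c⁻¹ * ∫⁻ x, h x) ^ 2 := by rw [hc2]; gcongr
      _ = (∫⁻ x, h x) ^ 2 := by
          rw [← mul_pow, ← mul_assoc, ENNReal.mul_inv_cancel hc0 hcM, one_mul]
  · exact fun t ht => ENNReal.exists_lt_toReal_inv_iSup_mul ha0 haM ht
  · exact fun t ht => ENNReal.exists_lt_toReal_inv_iSup_mul hb0 hbM ht
  · intro x y
    rw [← ENNReal.toReal_mul, ← ENNReal.toReal_pow]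
    refine ENNReal.toReal_mono
      (ENNReal.pow_ne_top (ne_top_of_le_ne_top ENNReal.one_ne_top (min_le_left _ _))) ?_
    obtain h1 | h1 := le_total 1 (c⁻¹ * h ((2 : ℝ)⁻¹ • (x + y)))
    · rw [min_eq_left h1, one_pow]
      exact mul_le_one' (hfa x) (hgb y)
    · rw [min_eq_right h1, mul_pow, ← ENNReal.inv_pow, hc2,
        ENNReal.mul_inv (.inl ha0) (.inl haM)]
      calc a⁻¹ * f x * (b⁻¹ * g y) = a⁻¹ * b⁻¹ * (f x * g y) := by ring
        _ ≤ _ := by gcongr; exact hfg x y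

theorem prekopaLeindler_real : PrekopaLeindler ℝ := by
  intro f g h hf hg hh hfg
  have hmin : ∀ {φ : ℝ → ENNReal}, Measurable φ →
      ∫⁻ x, φ x = ⨆ N : ℕ, ∫⁻ x, min (φ x) N := by
    intro φ hφ
    rw [← lintegral_iSup (by fun_prop)]
    · congr with x
      rw [← inf_iSup_eq, ENNReal.iSup_natCast, inf_top_eq]
    · intro i j hij x
      dsimp only
      gcongr
  rw [hmin hf, hmin hg]
  simp_rw [ENNReal.iSup_mul, ENNReal.mul_iSup]
  refine iSup₂_le fun N M => ?_
  refine lintegral_mul_lintegral_le_sq_of_bounded (by fun_prop) (by fun_prop) hh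
    (M := max (N : ENNReal) M) (by finiteness) (fun x => (min_le_right _ _).trans (le_max_left _ _))
    (fun x => (min_le_right _ _).trans (le_max_right _ _)) fun x y => ?_
  exact (mul_le_mul' (min_le_left _ _) (min_le_left _ _)).trans (hfg x y)

theorem PrekopaLeindler.prod {E F : Type*} [AddCommGroup E] [Module ℝ E] [MeasureSpace E]
    [AddCommGroup F] [Module ℝ F] [MeasureSpace F] [SFinite (volume : Measure F)]
    (hE : PrekopaLeindler E) (hF : PrekopaLeindler F) : PrekopaLeindler (E × F) := by
  intro f g h hf hg hh hfg
  rw [Measure.volume_eq_prod, lintegral_prod _ hf.aemeasurable, lintegral_prod _ hg.aemeasurable,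
    lintegral_prod _ hh.aemeasurable]
  refine hE _ _ _ hf.lintegral_prod_right' hg.lintegral_prod_right' hh.lintegral_prod_right'
    fun x y => ?_
  exact hF _ _ _ (by fun_prop) (by fun_prop) (by fun_prop) fun z w => hfg (x, z) (y, w)

theorem PrekopaLeindler.of_measurePreserving {E F : Type*} [AddCommGroup E] [Module ℝ E]
    [MeasureSpace E] [AddCommGroup F] [Module ℝ F] [MeasureSpace F] (hE : PrekopaLeindler E)
    {e : E → F} (he : MeasurePreserving e)
    (hadd : ∀ x y, e ((2 : ℝ)⁻¹ • (x + y)) = (2 : ℝ)⁻¹ • (e x + e y)) : PrekopaLeindler F := by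
  intro f g h hf hg hh hfg
  rw [← he.lintegral_comp hf, ← he.lintegral_comp hg, ← he.lintegral_comp hh]
  refine hE _ _ _ (hf.comp he.measurable) (hg.comp he.measurable) (hh.comp he.measurable)
    fun x y => ?_
  simpa only [hadd] using hfg (e x) (e y)

theorem prekopaLeindler_pi : ∀ n : ℕ, PrekopaLeindler (Fin n → ℝ)
  | 0 => by
    intro f g h hf hg hh hfg
    simp only [Measure.volume_pi_eq_dirac (0 : Fin 0 → ℝ), lintegral_dirac]
    simpa using hfg 0 0
  | n + 1 => by
    refine (prekopaLeindler_real.prod (prekopaLeindler_pi n)).of_measurePreserving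
      (volume_preserving_piFinSuccAbove (fun _ => ℝ) 0).symm fun x y => ?_
    ext i
    refine Fin.cases ?_ (fun j => ?_) i <;> simp [MeasurableEquiv.piFinSuccAbove, mul_add]

theorem prekopaLeindler_euclideanSpace (n : ℕ) : PrekopaLeindler (EuclideanSpace ℝ (Fin n)) :=
  (prekopaLeindler_pi n).of_measurePreserving
    (EuclideanSpace.volume_preserving_symm_measurableEquiv_toLp (Fin n)).symm fun x y => by
      ext i; simp

/-- The isodiametric inequality. -/
theorem volume_le_of_ediam_le {n : ℕ} (s : Set (EuclideanSpace ℝ (Fin n)))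
    (hs : Metric.ediam s ≠ ⊤) :
    volume s ≤ volume (Metric.ball (0 : EuclideanSpace ℝ (Fin n)) 1) / 2 ^ n *
      Metric.ediam s ^ n := by
  set A := closure s
  set r : ℝ := (Metric.ediam s).toReal / 2 with hr
  have hA : MeasurableSet A := isClosed_closure.measurableSet
  have hA' : ∀ x ∈ A, ∀ y ∈ A, dist x y ≤ 2 * r := fun x hx y hy => by
    rw [dist_edist, hr, mul_div_cancel₀ _ two_ne_zero]
    refine ENNReal.toReal_mono hs ?_
    rw [← Metric.ediam_closure]
    exact Metric.edist_le_ediam_of_mem hx hy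
  have h1 := prekopaLeindler_euclideanSpace n (A.indicator 1) ((-A).indicator 1)
    ((Metric.closedBall 0 r).indicator 1) (measurable_one.indicator hA)
    (measurable_one.indicator hA.neg) (measurable_one.indicator measurableSet_closedBall) ?_
  · simp only [lintegral_indicator_one hA, lintegral_indicator_one hA.neg,
      lintegral_indicator_one measurableSet_closedBall, Measure.measure_neg, ← sq] at h1
    have h2 := (ENNReal.pow_le_pow_left_iff two_ne_zero).1 h1
    rw [Measure.addHaar_closedBall _ _ (by positivity), finrank_euclideanSpace_fin, hr,
      ENNReal.ofReal_pow (by positivity), ENNReal.ofReal_div_of_pos two_pos,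
      ENNReal.ofReal_toReal hs] at h2
    refine (measure_mono subset_closure).trans (h2.trans_eq ?_)
    simp only [div_eq_mul_inv, mul_pow, ENNReal.inv_pow, ENNReal.ofReal_ofNat]
    ring
  · intro x y
    by_cases hx : x ∈ A <;> by_cases hy : y ∈ -A <;>
      simp only [hx, hy, Set.indicator_of_mem, Set.indicator_of_notMem, not_false_eq_true,
        mul_zero, zero_mul, zero_le]
    rw [Set.indicator_of_mem]
    · simp
    have := hA' x hx (-y) hy
    rw [dist_eq_norm, sub_neg_eq_add] at this
    rw [mem_closedBall_zero_iff, norm_smul]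
    norm_num
    linarith

open Filter Topology in
theorem hausdorffMeasure_ball_le (n : ℕ) :
    μH[n] (Metric.ball (0 : EuclideanSpace ℝ (Fin n)) 1) ≤ 2 ^ n := by
  set B := Metric.ball (0 : EuclideanSpace ℝ (Fin n)) 1 with hB
  set ω := volume B with hω
  have hω₀ : ω ≠ 0 := (Metric.measure_ball_pos _ _ one_pos).ne'
  have hω₁ : ω ≠ ⊤ := measure_ball_lt_top.ne
  have hball : ∀ x : EuclideanSpace ℝ (Fin n), ∀ r : ℝ, 0 ≤ r →
      Metric.ediam (Metric.closedBall x r) ^ (n : ℝ) ≤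
        2 ^ n / ω * volume (Metric.closedBall x r) := by
    intro x r hr
    rw [Measure.addHaar_closedBall _ _ hr, finrank_euclideanSpace_fin, mul_comm (ENNReal.ofReal _),
      ← mul_assoc, ENNReal.div_mul_cancel hω₀ hω₁, ENNReal.ofReal_pow hr, ENNReal.rpow_natCast,
      ← mul_pow]
    gcongr
    rw [← Metric.closedEBall_ofReal hr]
    exact Metric.ediam_closedEBall_le
  have hcov : ∀ k : ℕ, ∃ (t : Set (EuclideanSpace ℝ (Fin n))) (r : EuclideanSpace ℝ (Fin n) → ℝ),
      t.Countable ∧ (∀ x ∈ t, 0 < r x ∧ r x < 1 / (k + 1) ∧ Metric.closedBall x (r x) ⊆ B) ∧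
      volume (B \ ⋃ x ∈ t, Metric.closedBall x (r x)) = 0 ∧
      t.PairwiseDisjoint fun x => Metric.closedBall x (r x) := by
    intro k
    obtain ⟨t, r, h₁, h₂, h₃, h₄, h₅⟩ := Besicovitch.exists_disjoint_closedBall_covering_ae volume
      (fun _ => Set.univ) B (fun x _ δ hδ => by simpa using hδ)
      (fun x => min (1 / (k + 1)) (1 - ‖x‖)) (fun x hx => by
        rw [hB, mem_ball_zero_iff] at hx
        exact lt_min (by positivity) (by linarith))
    refine ⟨t, r, h₁, fun x hx => ?_, h₄, h₅⟩
    have h := (h₃ x hx).2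
    refine ⟨h.1, h.2.trans_le (min_le_left _ _), fun y hy => ?_⟩
    have h₆ := h.2.trans_le (min_le_right _ _)
    rw [hB, mem_ball_zero_iff]
    rw [mem_closedBall_iff_norm] at hy
    linarith [norm_le_norm_add_norm_sub' y x]
  choose t r ht htr htB htd using hcov
  have := fun k => (ht k).to_subtype
  set N := ⋃ k, (B \ ⋃ x ∈ t k, Metric.closedBall x (r k x)) with hN
  have hN₀ : μH[n] N = 0 := by
    have h₁ : volume N = 0 := measure_iUnion_null htB
    rw [Measure.isAddLeftInvariant_eq_smul (μH[n] : Measure (EuclideanSpace ℝ (Fin n))) volume]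
    simp [h₁]
  calc μH[n] B ≤ μH[n] (B \ N) + μH[n] N := by
        refine (measure_mono ?_).trans (measure_union_le (B \ N) N)
        simp
    _ = μH[n] (B \ N) := by rw [hN₀, add_zero]
    _ ≤ liminf (fun k : ℕ => ∑' x : t k, Metric.ediam (Metric.closedBall x.1 (r k x)) ^ (n : ℝ))
          atTop := by
        refine Measure.hausdorffMeasure_le_liminf_tsum n (B \ N) (l := atTop)
          (fun k : ℕ => 2 * ENNReal.ofReal (1 / (k + 1))) ?_
          (fun k (x : t k) => Metric.closedBall x.1 (r k x)) ?_ ?_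
        · have := (ENNReal.continuous_ofReal.tendsto 0).comp
            (tendsto_one_div_add_atTop_nhds_zero_nat (𝕜 := ℝ))
          simpa using ENNReal.Tendsto.const_mul this (.inr (by simp))
        · refine .of_forall fun k x => ?_
          have hx := htr k x x.2
          rw [← Metric.closedEBall_ofReal hx.1.le]
          refine Metric.ediam_closedEBall_le.trans ?_
          gcongr
          exact hx.2.1.le
        · refine .of_forall fun k x hx => ?_
          by_contra h
          refine hx.2 (Set.mem_iUnion.2 ⟨k, hx.1, ?_⟩)
          simpa using h
    _ ≤ liminf (fun _ : ℕ => (2 : ENNReal) ^ n) atTop := by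
        refine liminf_le_liminf (.of_forall fun k => ?_)
        calc ∑' x : t k, Metric.ediam (Metric.closedBall x.1 (r k x)) ^ (n : ℝ)
            ≤ ∑' x : t k, 2 ^ n / ω * volume (Metric.closedBall x.1 (r k x)) :=
              ENNReal.tsum_le_tsum fun x => hball _ _ (htr k x x.2).1.le
          _ = 2 ^ n / ω * volume (⋃ x ∈ t k, Metric.closedBall x (r k x)) := by
              rw [ENNReal.tsum_mul_left, measure_biUnion (ht k) (htd k)
                fun x _ => measurableSet_closedBall]
          _ ≤ 2 ^ n / ω * ω := by
              gcongr
              exact measure_mono (Set.iUnion₂_subset fun x hx => (htr k x hx).2.2)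
          _ = 2 ^ n := ENNReal.div_mul_cancel hω₀ hω₁
    _ = 2 ^ n := by simp

theorem stdHausdorff_le_volume (n : ℕ) : stdHausdorff n (EuclideanSpace ℝ (Fin n)) ≤ volume := by
  have h := Measure.isAddLeftInvariant_eq_smul (μH[n] : Measure (EuclideanSpace ℝ (Fin n))) volume
  set κ := Measure.addHaarScalarFactor (μH[n] : Measure (EuclideanSpace ℝ (Fin n))) volume
  have h₁ := hausdorffMeasure_ball_le n
  rw [h] at h₁
  rw [stdHausdorff, h]
  intro s
  simp only [Measure.smul_apply, ENNReal.smul_def, smul_eq_mul] at *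
  rw [← mul_assoc]
  refine mul_le_of_le_one_left' ?_
  rw [mul_comm, ← mul_div_assoc]
  exact ENNReal.div_le_of_le_mul (by simpa using h₁)

theorem volume_le_stdHausdorff (n : ℕ) : volume ≤ stdHausdorff n (EuclideanSpace ℝ (Fin n)) := by
  set c := volume (Metric.ball (0 : EuclideanSpace ℝ (Fin n)) 1) / 2 ^ n with hc
  have hc₀ : c ≠ 0 := by
    simp [hc, ENNReal.div_eq_zero_iff, (Metric.measure_ball_pos _ _ one_pos).ne']
  have hc₁ : c ≠ ⊤ := by
    rw [hc]; exact ENNReal.div_ne_top measure_ball_lt_top.ne (by simp)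
  have h := Measure.le_hausdorffMeasure n (c⁻¹ • (volume : Measure (EuclideanSpace ℝ (Fin n)))) 1
    one_pos fun s hs => by
      rw [Measure.smul_apply, smul_eq_mul, mul_comm, ← div_eq_mul_inv, ENNReal.rpow_natCast]
      refine ENNReal.div_le_of_le_mul ?_
      rw [mul_comm]
      exact volume_le_of_ediam_le s (ne_top_of_le_ne_top ENNReal.one_ne_top hs)
  intro s
  rw [stdHausdorff, Measure.smul_apply, smul_eq_mul, ← hc]
  calc volume s = c * (c⁻¹ * volume s) := by
        rw [← mul_assoc, ENNReal.mul_inv_cancel hc₀ hc₁, one_mul]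
    _ ≤ c * μH[n] s := by gcongr; simpa using h s

/-- The upper integral of `g` is at most `B`. -/
def UpperLIntegralLE (g : ℝ → ENNReal) (B : ENNReal) : Prop :=
  ∃ G : ℝ → ENNReal, Measurable G ∧ (∀ t, g t ≤ G t) ∧ ∫⁻ t, G t ≤ B

namespace UpperLIntegralLE

variable {g g' : ℝ → ENNReal} {B B' : ENNReal}

theorem mono (h : UpperLIntegralLE g B) (hg : ∀ t, g' t ≤ g t) (hB : B ≤ B') :
    UpperLIntegralLE g' B' :=
  let ⟨G, hG, hgG, hGB⟩ := h
  ⟨G, hG, fun t => (hg t).trans (hgG t), hGB.trans hB⟩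

theorem add (h : UpperLIntegralLE g B) (h' : UpperLIntegralLE g' B') :
    UpperLIntegralLE (fun t => g t + g' t) (B + B') := by
  obtain ⟨G, hG, hgG, hGB⟩ := h
  obtain ⟨G', hG', hgG', hGB'⟩ := h'
  exact ⟨fun t => G t + G' t, hG.add hG', fun t => add_le_add (hgG t) (hgG' t),
    (lintegral_add_left hG _).trans_le (add_le_add hGB hGB')⟩

theorem const_mul (h : UpperLIntegralLE g B) (c : ENNReal) :
    UpperLIntegralLE (fun t => c * g t) (c * B) := by
  obtain ⟨G, hG, hgG, hGB⟩ := h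
  exact ⟨fun t => c * G t, hG.const_mul c, fun t => mul_le_mul_right (hgG t) c,
    (lintegral_const_mul c hG).trans_le (mul_le_mul_right hGB c)⟩

theorem tsum {g : ℕ → ℝ → ENNReal} {B : ℕ → ENNReal} (h : ∀ i, UpperLIntegralLE (g i) (B i)) :
    UpperLIntegralLE (fun t => ∑' i, g i t) (∑' i, B i) := by
  choose G hG hgG hGB using h
  refine ⟨fun t => ∑' i, G i t, Measurable.tsum hG,
    fun t => ENNReal.tsum_le_tsum fun i => hgG i t, ?_⟩
  rw [lintegral_tsum fun i => (hG i).aemeasurable]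
  exact ENNReal.tsum_le_tsum hGB

open Filter in
theorem of_le_liminf {f : ℕ → ℝ → ENNReal} {B : ℕ → ENNReal}
    (h : ∀ i, UpperLIntegralLE (f i) (B i)) (hg : ∀ t, g t ≤ liminf (fun i => f i t) atTop) :
    UpperLIntegralLE g (liminf B atTop) := by
  choose G hG hgG hGB using h
  refine ⟨fun t => liminf (fun i => G i t) atTop, .liminf hG, fun t => (hg t).trans
    (liminf_le_liminf (.of_forall fun i => hgG i t)), (lintegral_liminf_le hG).trans
    (liminf_le_liminf (.of_forall hGB))⟩

open Filter Topology in
theorem of_tendsto {b : ℕ → ENNReal} (h : ∀ i, UpperLIntegralLE g (b i))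
    (hb : Tendsto b atTop (𝓝 B)) : UpperLIntegralLE g B :=
  hb.liminf_eq ▸ of_le_liminf h fun t => by simp

theorem measure_iUnion {X : Type*} [MeasurableSpace X] {μ : Measure X} {s : Set X}
    {p : ℕ → Set X} (hs : s ⊆ ⋃ i, p i) {u : X → ℝ} {B : ℕ → ENNReal}
    (h : ∀ i, UpperLIntegralLE (fun t => μ (s ∩ p i ∩ u ⁻¹' {t})) (B i)) :
    UpperLIntegralLE (fun t => μ (s ∩ u ⁻¹' {t})) (∑' i, B i) := by
  refine (tsum h).mono (fun t => ?_) le_rfl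
  refine (measure_mono ?_).trans (measure_iUnion_le _)
  rw [← Set.iUnion_inter, ← Set.inter_iUnion, Set.inter_eq_left.2 hs]

end UpperLIntegralLE

section Eilenberg

variable {X : Type*} [EMetricSpace X] [MeasurableSpace X] [BorelSpace X]

theorem exists_cover_tsum_ediam_pow_le (d : ℕ) (s : Set X) (hs : μH[d] s ≠ ⊤) {ε : ENNReal}
    (hε : 0 < ε) : ∃ U : ℕ → Set X, s ⊆ ⋃ i, U i ∧ (∀ i, Metric.ediam (U i) ≤ ε) ∧
      ∑' i, ⨆ _ : (U i).Nonempty, Metric.ediam (U i) ^ d ≤ μH[d] s + ε := by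
  have h : ⨅ (t : ℕ → Set X) (_ : s ⊆ ⋃ n, t n) (_ : ∀ n, Metric.ediam (t n) ≤ ε),
      ∑' n, ⨆ _ : (t n).Nonempty, Metric.ediam (t n) ^ (d : ℝ) < μH[d] s + ε := by
    refine lt_of_le_of_lt ?_ (ENNReal.lt_add_right hs hε.ne')
    conv_rhs => rw [Measure.hausdorffMeasure_apply]
    exact le_iSup₂ (f := fun (r : ENNReal) (_ : 0 < r) => ⨅ (t : ℕ → Set X) (_ : s ⊆ ⋃ n, t n)
      (_ : ∀ n, Metric.ediam (t n) ≤ r), ∑' n, ⨆ _ : (t n).Nonempty, Metric.ediam (t n) ^ (d : ℝ))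
      ε hε
  simp only [iInf_lt_iff, ENNReal.rpow_natCast] at h
  obtain ⟨U, h₁, h₂, h₃⟩ := h
  exact ⟨U, h₁, h₂, h₃.le⟩

open Filter Topology in
/-- Eilenberg's inequality. -/
theorem upperLIntegralLE_hausdorffMeasure_fiber (m : ℕ) {s : Set X} (hs : μH[(m + 1 : ℕ)] s ≠ ⊤)
    {u : X → ℝ} {K : NNReal} (hu : LipschitzOnWith K u s) :
    UpperLIntegralLE (fun t => μH[m] (s ∩ u ⁻¹' {t})) (K * μH[(m + 1 : ℕ)] s) := by
  have hε : ∀ k : ℕ, (0 : ENNReal) < (k + 1 : ENNReal)⁻¹ := fun k => by simp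
  have hε₀ : Tendsto (fun k : ℕ => (k + 1 : ENNReal)⁻¹) atTop (𝓝 0) := by
    simpa using (tendsto_add_atTop_iff_nat 1).2 ENNReal.tendsto_inv_nat_nhds_zero
  choose U hU hUε hUs using fun k => exists_cover_tsum_ediam_pow_le (m + 1) s hs (hε k)
  have hdiam : ∀ V : Set X, volume (u '' (s ∩ V)) ≤ K * Metric.ediam V := fun V => by
    refine (Real.volume_le_diam _).trans (Metric.ediam_image_le_iff.2 fun x hx y hy => ?_)
    refine (hu hx.1 hy.1).trans ?_
    gcongr
    exact Metric.edist_le_ediam_of_mem hx.2 hy.2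
  let W : ℕ → ℕ → Set ℝ := fun k i => toMeasurable volume (u '' (s ∩ U k i))
  have hstep : ∀ k, UpperLIntegralLE
      (fun t => ∑' i, (W k i).indicator (fun _ => Metric.ediam (U k i) ^ m) t)
      (K * (μH[(m + 1 : ℕ)] s + (k + 1 : ENNReal)⁻¹)) := fun k => by
    refine ⟨_, .tsum fun i => measurable_const.indicator (measurableSet_toMeasurable _ _),
      fun t => le_rfl, ?_⟩
    rw [lintegral_tsum fun i =>
      (measurable_const.indicator (measurableSet_toMeasurable _ _)).aemeasurable]
    refine le_trans ?_ (mul_le_mul_right (hUs k) _)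
    rw [← ENNReal.tsum_mul_left]
    refine ENNReal.tsum_le_tsum fun i => ?_
    rw [lintegral_indicator_const (measurableSet_toMeasurable _ _), measure_toMeasurable]
    obtain h | h := (U k i).eq_empty_or_nonempty
    · simp [h]
    · simp only [h, iSup_pos]
      calc Metric.ediam (U k i) ^ m * volume (u '' (s ∩ U k i))
          ≤ Metric.ediam (U k i) ^ m * (K * Metric.ediam (U k i)) := by gcongr; exact hdiam _
        _ = K * Metric.ediam (U k i) ^ (m + 1) := by ring
  have hlim : Tendsto (fun k : ℕ => K * (μH[(m + 1 : ℕ)] s + (k + 1 : ENNReal)⁻¹)) atTop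
      (𝓝 (K * μH[(m + 1 : ℕ)] s)) := by
    refine ENNReal.Tendsto.const_mul ?_ (.inr (by simp))
    simpa using tendsto_const_nhds.add hε₀
  rw [← hlim.liminf_eq]
  refine .of_le_liminf hstep fun t => ?_
  have h := Measure.hausdorffMeasure_le_liminf_tsum (ι := fun k => {i // t ∈ W k i}) m
    (s ∩ u ⁻¹' {t}) (l := atTop) (fun k : ℕ => (k + 1 : ENNReal)⁻¹) hε₀ (fun k i => U k i)
    (.of_forall fun k i => hUε k i) (.of_forall fun k x hx => by
      obtain ⟨i, hi⟩ := Set.mem_iUnion.1 (hU k hx.1)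
      exact Set.mem_iUnion.2 ⟨⟨i, subset_toMeasurable _ _ ⟨x, ⟨hx.1, hi⟩, hx.2⟩⟩, hi⟩)
  refine h.trans_eq ?_
  congr with k
  simp only [ENNReal.rpow_natCast]
  exact tsum_subtype {i | t ∈ W k i} fun i => Metric.ediam (U k i) ^ m

end Eilenberg

section Critical

open Filter Topology in
/-- Almost every fiber of a function meets its critical set in a null set. -/
theorem upperLIntegralLE_fiber_critical_of_finite {m : ℕ}
    {u : EuclideanSpace ℝ (Fin (m + 1)) → ℝ} {s : Set (EuclideanSpace ℝ (Fin (m + 1)))}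
    (hs : MeasurableSet s) (hfin : volume s ≠ ⊤)
    (hu : ∀ x ∈ s, HasFDerivAt u (0 : EuclideanSpace ℝ (Fin (m + 1)) →L[ℝ] ℝ) x) :
    UpperLIntegralLE (fun t => μH[m] (s ∩ u ⁻¹' {t})) 0 := by
  have hfin' : μH[(m + 1 : ℕ)] s ≠ ⊤ := by
    rw [Measure.isAddLeftInvariant_eq_smul
      (μH[(m + 1 : ℕ)] : Measure (EuclideanSpace ℝ (Fin (m + 1)))) volume]
    rw [Measure.smul_apply, ENNReal.smul_def, smul_eq_mul]
    finiteness
  obtain rfl | hne := s.eq_empty_or_nonempty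
  · exact ⟨0, measurable_zero, by simp, by simp⟩
  have hstep : ∀ ε : NNReal, ε ≠ 0 →
      UpperLIntegralLE (fun t => μH[m] (s ∩ u ⁻¹' {t})) (ε * μH[(m + 1 : ℕ)] s) := by
    intro ε hε
    obtain ⟨p, A, hp, hpm, hsp, happ, hA⟩ :=
      exists_partition_approximatesLinearOn_of_hasFDerivWithinAt u s (fun _ => 0)
        (fun x hx => (hu x hx).hasFDerivWithinAt) (fun _ => ε) (fun _ => hε)
    have hsum : ∑' i, ε * μH[(m + 1 : ℕ)] (s ∩ p i) = ε * μH[(m + 1 : ℕ)] s := by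
      rw [ENNReal.tsum_mul_left, ← measure_iUnion
        (fun i j hij => (hp hij).mono Set.inter_subset_right Set.inter_subset_right)
        (fun i => hs.inter (hpm i)), ← Set.inter_iUnion, Set.inter_eq_left.2 hsp]
    rw [← hsum]
    refine .measure_iUnion hsp fun i => upperLIntegralLE_hausdorffMeasure_fiber m
      (ne_top_of_le_ne_top hfin' (measure_mono Set.inter_subset_left)) ?_
    refine LipschitzOnWith.of_dist_le_mul fun x hx y hy => ?_
    obtain ⟨_, _, h0⟩ := hA hne i
    simpa [h0, dist_eq_norm] using happ i x hx y hy
  refine .of_tendsto (fun k : ℕ => hstep (k + 1 : NNReal)⁻¹ (by positivity)) ?_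
  have hε₀ : Tendsto (fun k : ℕ => (((k + 1 : NNReal)⁻¹ : NNReal) : ENNReal)) atTop (𝓝 0) := by
    rw [← ENNReal.coe_zero, ENNReal.tendsto_coe]
    exact tendsto_one_div_add_atTop_nhds_zero_nat (𝕜 := NNReal) |>.congr fun k => by simp
  simpa using ENNReal.Tendsto.mul_const hε₀ (.inr hfin')

theorem upperLIntegralLE_fiber_critical {m : ℕ}
    {u : EuclideanSpace ℝ (Fin (m + 1)) → ℝ} {s : Set (EuclideanSpace ℝ (Fin (m + 1)))}
    (hs : MeasurableSet s)
    (hu : ∀ x ∈ s, HasFDerivAt u (0 : EuclideanSpace ℝ (Fin (m + 1)) →L[ℝ] ℝ) x) :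
    UpperLIntegralLE (fun t => μH[m] (s ∩ u ⁻¹' {t})) 0 := by
  rw [← tsum_zero (α := ENNReal) (β := ℕ)]
  refine .measure_iUnion (p := spanningSets volume) (by simp [iUnion_spanningSets]) fun i =>
    upperLIntegralLE_fiber_critical_of_finite (hs.inter (measurableSet_spanningSets _ i)) ?_
      fun x hx => hu x hx.1
  exact ne_top_of_le_ne_top (measure_spanningSets_lt_top volume i).ne
    (measure_mono Set.inter_subset_right)

end Critical

section Coordinates

/-- Splitting off the zeroth coordinate of a Euclidean space. -/
noncomputable def euclideanSplit (m : ℕ) :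
    EuclideanSpace ℝ (Fin (m + 1)) ≃L[ℝ] ℝ × EuclideanSpace ℝ (Fin m) :=
  LinearEquiv.toContinuousLinearEquiv
    { toFun := fun x => (x 0, WithLp.toLp 2 fun i => x i.succ)
      map_add' := fun x y => rfl
      map_smul' := fun c x => rfl
      invFun := fun p => WithLp.toLp 2 (Fin.cons p.1 p.2)
      left_inv := fun x => by
        ext i
        refine Fin.cases ?_ (fun i => ?_) i <;> simp
      right_inv := fun p => by ext <;> simp }

theorem euclideanSplit_apply {m : ℕ} (x : EuclideanSpace ℝ (Fin (m + 1))) :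
    euclideanSplit m x = (x 0, WithLp.toLp 2 fun i => x i.succ) :=
  rfl

theorem measurePreserving_euclideanSplit (m : ℕ) : MeasurePreserving (euclideanSplit m) :=
  (((MeasurePreserving.id volume).prod (PiLp.volume_preserving_toLp (Fin m))).comp
    (volume_preserving_piFinSuccAbove (fun _ => ℝ) 0)).comp (PiLp.volume_preserving_ofLp _)

theorem exists_coordinates {m : ℕ} {e : EuclideanSpace ℝ (Fin (m + 1))} (he : ‖e‖ = 1) :
    ∃ S : EuclideanSpace ℝ (Fin (m + 1)) ≃L[ℝ] ℝ × EuclideanSpace ℝ (Fin m),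
      MeasurePreserving S ∧ S e = (1, 0) ∧ (∀ x, (S x).1 = inner ℝ e x) ∧
        ∀ x, ‖(S x).2‖ ≤ ‖x‖ ∧ ‖x‖ ≤ |(S x).1| + ‖(S x).2‖ := by
  obtain ⟨b, hb⟩ := Orthonormal.exists_orthonormalBasis_extension_of_card_eq (𝕜 := ℝ)
    (ι := Fin (m + 1)) (by simp) (v := fun _ => e) (s := {0}) (by simp [he])
  have hb₀ : b 0 = e := hb 0 rfl
  have hnorm : ∀ x, ‖x‖ ^ 2 =
      (euclideanSplit m (b.repr x)).1 ^ 2 + ‖(euclideanSplit m (b.repr x)).2‖ ^ 2 := fun x => by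
    rw [← b.repr.norm_map x, EuclideanSpace.real_norm_sq_eq, EuclideanSpace.real_norm_sq_eq,
      Fin.sum_univ_succ]
    rfl
  refine ⟨b.repr.toContinuousLinearEquiv.trans (euclideanSplit m),
    (measurePreserving_euclideanSplit m).comp b.measurePreserving_repr, ?_, fun x => ?_,
    fun x => ⟨?_, ?_⟩⟩
  · have h : b.repr e = EuclideanSpace.single 0 1 := by rw [← hb₀, b.repr_self]
    change euclideanSplit m (b.repr e) = _
    rw [h]
    ext <;> simp [euclideanSplit_apply]
  · rw [← hb₀]
    exact b.repr_apply_apply x 0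
  · refine le_of_sq_le_sq ?_ (norm_nonneg x)
    rw [hnorm x]
    exact le_add_of_nonneg_left (sq_nonneg _)
  · refine le_of_sq_le_sq ?_ (by positivity)
    rw [hnorm x]
    change _ ≤ (|(euclideanSplit m (b.repr x)).1| + ‖(euclideanSplit m (b.repr x)).2‖) ^ 2
    nlinarith [sq_abs (euclideanSplit m (b.repr x)).1,
      mul_nonneg (abs_nonneg (euclideanSplit m (b.repr x)).1)
        (norm_nonneg (euclideanSplit m (b.repr x)).2)]

end Coordinates

section Regular

variable {m : ℕ} {u : EuclideanSpace ℝ (Fin (m + 1)) → ℝ}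

theorem abs_det_id_add_smulRight_le {e : EuclideanSpace ℝ (Fin (m + 1))} (he : ‖e‖ = 1)
    (D : EuclideanSpace ℝ (Fin (m + 1)) →L[ℝ] ℝ) :
    |(ContinuousLinearMap.id ℝ _ + (D - innerSL ℝ e).smulRight e).det| ≤ ‖D‖ := by
  have h : (ContinuousLinearMap.id ℝ _ + (D - innerSL ℝ e).smulRight e).det = D e := by
    have := LinearMap.transvection.det (D - innerSL ℝ e).toLinearMap e
    simp only [ContinuousLinearMap.coe_coe, sub_apply, innerSL_apply_apply,
      real_inner_self_eq_norm_sq, he] at this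
    rw [ContinuousLinearMap.det]
    convert! this using 1
    ring
  rw [h, ← Real.norm_eq_abs]
  simpa [he] using D.le_opNorm e

theorem upperLIntegralLE_fiber_of_approximatesLinearOn {A : Set (EuclideanSpace ℝ (Fin (m + 1)))}
    (hA : MeasurableSet A) {L : EuclideanSpace ℝ (Fin (m + 1)) →L[ℝ] ℝ} (hL : L ≠ 0) {ε : NNReal}
    (hε : ε < 1) (happ : ApproximatesLinearOn u L A (ε * ‖L‖₊))
    (hu : ∀ x ∈ A, HasFDerivAt u (fderiv ℝ u x) x) :
    UpperLIntegralLE (fun t => stdHausdorff m _ (A ∩ u ⁻¹' {t}))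
      (((1 - ε)⁻¹ : NNReal) ^ m * ∫⁻ x in A, ENNReal.ofReal ‖fderiv ℝ u x‖) := by
  have hL' : 0 < ‖L‖ := norm_pos_iff.2 hL
  have hε' : 0 < 1 - (ε : ℝ) := sub_pos.2 hε
  set e := ‖L‖⁻¹ • (InnerProductSpace.toDual ℝ (EuclideanSpace ℝ (Fin (m + 1)))).symm L with he
  have hLe : ∀ x, L x = ‖L‖ * inner ℝ e x := fun x => by
    simp [he, inner_smul_left, hL'.ne']
  have he₁ : ‖e‖ = 1 := by simp [he, norm_smul, hL'.ne']
  obtain ⟨S, hS, hSe, hSi, hSn⟩ := exists_coordinates he₁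
  have hanti : ∀ x ∈ A, ∀ y ∈ A, u x = u y →
      ‖x - y‖ ≤ ((1 - ε)⁻¹ : NNReal) * ‖(S x).2 - (S y).2‖ := by
    intro x hx y hy hxy
    have h₁ := happ x hx y hy
    rw [hxy, sub_self, zero_sub, norm_neg, Real.norm_eq_abs, hLe, ← hSi, abs_mul, abs_norm,
      NNReal.coe_mul, coe_nnnorm, mul_comm (ε : ℝ), mul_assoc, mul_le_mul_iff_right₀ hL'] at h₁
    have h₂ := (hSn (x - y)).2
    rw [NNReal.coe_inv, NNReal.coe_sub hε.le, NNReal.coe_one, ← div_eq_inv_mul, le_div_iff₀ hε',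
      ← Prod.snd_sub, ← map_sub]
    linarith
  let Φ : EuclideanSpace ℝ (Fin (m + 1)) → EuclideanSpace ℝ (Fin (m + 1)) :=
    fun x => x + (u x - inner ℝ e x) • e
  have hSΦ : ∀ x, S (Φ x) = (u x, (S x).2) := fun x => by
    simp only [Φ, map_add, map_smul, hSe, ← hSi]
    ext <;> simp
  have hΦ' : ∀ x ∈ A, HasFDerivWithinAt Φ
      (ContinuousLinearMap.id ℝ _ + (fderiv ℝ u x - innerSL ℝ e).smulRight e) A x := fun x hx =>
    ((hasFDerivAt_id x).add
      (((hu x hx).sub (innerSL ℝ e).hasFDerivAt).smul_const e)).hasFDerivWithinAt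
  have hinj : Set.InjOn Φ A := fun x hx y hy hxy => by
    have h := congrArg S hxy
    rw [hSΦ, hSΦ, Prod.mk.injEq] at h
    simpa [h.2, sub_eq_zero] using hanti x hx y hy h.1
  have hmeas : MeasurableSet (S.symm ⁻¹' (Φ '' A)) :=
    S.symm.continuous.measurable (measurable_image_of_fderivWithin hA hΦ' hinj)
  refine ⟨fun t => ((1 - ε)⁻¹ : NNReal) ^ m * volume (Prod.mk t ⁻¹' (S.symm ⁻¹' (Φ '' A))),
    (measurable_measure_prodMk_left hmeas).const_mul _, fun t => ?_, ?_⟩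
  · have hfib : μH[m] (A ∩ u ⁻¹' {t}) ≤ ((1 - ε)⁻¹ : NNReal) ^ m *
        μH[m] (Prod.mk t ⁻¹' (S.symm ⁻¹' (Φ '' A))) := by
      let ι : ↥(A ∩ u ⁻¹' {t}) → EuclideanSpace ℝ (Fin (m + 1)) := Subtype.val
      have hι : AntilipschitzWith (1 - ε)⁻¹ fun x : ↥(A ∩ u ⁻¹' {t}) => (S x).2 :=
        .of_le_mul_dist fun x y => by
          simpa [Subtype.dist_eq, dist_eq_norm] using
            hanti x x.2.1 y y.2.1 (x.2.2.trans y.2.2.symm)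
      have h := hι.le_hausdorffMeasure_image m.cast_nonneg Set.univ
      rw [← isometry_subtype_coe.hausdorffMeasure_image (.inl m.cast_nonneg), Set.image_univ,
        Subtype.range_coe, ENNReal.rpow_natCast] at h
      refine h.trans (mul_le_mul_right (measure_mono ?_) _)
      rintro _ ⟨⟨x, hx, rfl⟩, -, rfl⟩
      exact ⟨x, hx, by rw [ContinuousLinearEquiv.eq_symm_apply, hSΦ]⟩
    calc stdHausdorff m _ (A ∩ u ⁻¹' {t})
        ≤ ((1 - ε)⁻¹ : NNReal) ^ m *
          stdHausdorff m _ (Prod.mk t ⁻¹' (S.symm ⁻¹' (Φ '' A))) := by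
          simp only [stdHausdorff, Measure.smul_apply, smul_eq_mul]
          rw [mul_left_comm]
          gcongr
      _ ≤ _ := by exact mul_le_mul_right (stdHausdorff_le_volume m _) _
  · rw [lintegral_const_mul _ (measurable_measure_prodMk_left hmeas),
      ← Measure.prod_apply hmeas, ← Measure.volume_eq_prod]
    gcongr
    calc volume (S.symm ⁻¹' (Φ '' A))
        = volume (S ⁻¹' (S.symm ⁻¹' (Φ '' A))) :=
          (hS.measure_preimage hmeas.nullMeasurableSet).symm
      _ = volume (Φ '' A) := by simp [← Set.preimage_comp]
      _ ≤ _ := addHaar_image_le_lintegral_abs_det_fderiv volume hA hΦ'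
      _ ≤ _ := lintegral_mono fun x =>
          ENNReal.ofReal_le_ofReal (abs_det_id_add_smulRight_le he₁ _)

open Filter Topology in
theorem upperLIntegralLE_fiber_regular {s : Set (EuclideanSpace ℝ (Fin (m + 1)))}
    (hs : MeasurableSet s) (hu : ∀ x ∈ s, HasFDerivAt u (fderiv ℝ u x) x)
    (hu₀ : ∀ x ∈ s, fderiv ℝ u x ≠ 0) :
    UpperLIntegralLE (fun t => stdHausdorff m _ (s ∩ u ⁻¹' {t}))
      (∫⁻ x in s, ENNReal.ofReal ‖fderiv ℝ u x‖) := by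
  obtain rfl | hne := s.eq_empty_or_nonempty
  · exact ⟨0, measurable_zero, by simp, by simp⟩
  have hstep : ∀ ε : NNReal, 0 < ε → ε < 1 → UpperLIntegralLE
      (fun t => stdHausdorff m _ (s ∩ u ⁻¹' {t}))
      (((1 - ε)⁻¹ : NNReal) ^ m * ∫⁻ x in s, ENNReal.ofReal ‖fderiv ℝ u x‖) := by
    intro ε hε hε₁
    classical
    obtain ⟨p, A, hp, hpm, hsp, happ, hA⟩ :=
      exists_partition_approximatesLinearOn_of_hasFDerivWithinAt u s (fderiv ℝ u)
        (fun x hx => (hu x hx).hasFDerivWithinAt) (fun L => if L = 0 then 1 else ε * ‖L‖₊)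
        (fun L => by split_ifs with h <;> simp [hε.ne', h])
    have hsum : ∑' i, (((1 - ε)⁻¹ : NNReal) : ENNReal) ^ m *
        ∫⁻ x in s ∩ p i, ENNReal.ofReal ‖fderiv ℝ u x‖ =
          ((1 - ε)⁻¹ : NNReal) ^ m * ∫⁻ x in s, ENNReal.ofReal ‖fderiv ℝ u x‖ := by
      rw [ENNReal.tsum_mul_left, ← lintegral_iUnion (fun i => hs.inter (hpm i))
        (fun i j hij => (hp hij).mono Set.inter_subset_right Set.inter_subset_right),
        ← Set.inter_iUnion, Set.inter_eq_left.2 hsp]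
    rw [← hsum]
    refine .measure_iUnion hsp fun i => ?_
    obtain ⟨y, hy, hAy⟩ := hA hne i
    have hAi : A i ≠ 0 := hAy ▸ hu₀ y hy
    exact upperLIntegralLE_fiber_of_approximatesLinearOn (hs.inter (hpm i)) hAi hε₁
      (by simpa only [hAi, if_false] using happ i) fun x hx => hu x hx.1
  refine .of_tendsto (fun k : ℕ => hstep (k + 2 : NNReal)⁻¹ (by positivity)
    (inv_lt_one_of_one_lt₀ (by linarith [show (0 : NNReal) ≤ k from zero_le]))) ?_
  have hlim : Tendsto (fun k : ℕ => (1 - (k + 2 : NNReal)⁻¹)⁻¹ ^ m) atTop (𝓝 1) := by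
    have h₁ : Tendsto (fun k : ℕ => (k + 2 : NNReal)⁻¹) atTop (𝓝 0) := by
      simpa using (tendsto_add_atTop_iff_nat 2).2 (tendsto_inv_atTop_nhds_zero_nat (𝕜 := NNReal))
    have h₂ : Tendsto (fun k : ℕ => 1 - (k + 2 : NNReal)⁻¹) atTop (𝓝 1) := by
      simpa using tendsto_const_nhds.sub h₁
    simpa using (h₂.inv₀ one_ne_zero).pow m
  have := ENNReal.Tendsto.mul_const (ENNReal.tendsto_coe.2 hlim)
    (b := ∫⁻ x in s, ENNReal.ofReal ‖fderiv ℝ u x‖) (.inl (by simp))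
  simpa only [ENNReal.coe_pow, ENNReal.coe_one, one_mul] using this

end Regular

section Coarea

variable {m : ℕ} {u : EuclideanSpace ℝ (Fin (m + 1)) → ℝ} {K : NNReal}

theorem LipschitzWith.upperLIntegralLE_fiber (hu : LipschitzWith K u)
    {s : Set (EuclideanSpace ℝ (Fin (m + 1)))} (hs : MeasurableSet s) :
    UpperLIntegralLE (fun t => stdHausdorff m _ (s ∩ u ⁻¹' {t}))
      (∫⁻ x in s, ENNReal.ofReal ‖fderiv ℝ u x‖) := by
  have hd : MeasurableSet {x | DifferentiableAt ℝ u x} := measurableSet_of_differentiableAt ℝ u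
  have hc : MeasurableSet {x | fderiv ℝ u x = 0} :=
    measurable_fderiv ℝ u (measurableSet_singleton 0)
  have h₀ : μH[(m + 1 : ℕ)] (s \ {x | DifferentiableAt ℝ u x}) = 0 := by
    rw [Measure.isAddLeftInvariant_eq_smul
      (μH[(m + 1 : ℕ)] : Measure (EuclideanSpace ℝ (Fin (m + 1)))) volume, Measure.smul_apply,
      measure_mono_null (fun x hx => hx.2) hu.ae_differentiableAt, smul_zero]
  have h₁ : UpperLIntegralLE
      (fun t => μH[m] ((s \ {x | DifferentiableAt ℝ u x}) ∩ u ⁻¹' {t})) 0 := by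
    have h := upperLIntegralLE_hausdorffMeasure_fiber m (h₀.trans_ne ENNReal.zero_ne_top)
      hu.lipschitzOnWith
    rwa [h₀, mul_zero] at h
  have h₂ := upperLIntegralLE_fiber_critical (u := u)
    (s := s ∩ {x | DifferentiableAt ℝ u x} ∩ {x | fderiv ℝ u x = 0}) ((hs.inter hd).inter hc)
    fun x hx => by simpa [show fderiv ℝ u x = 0 from hx.2] using hx.1.2.hasFDerivAt
  have h₃ := upperLIntegralLE_fiber_regular (u := u)
    (s := (s ∩ {x | DifferentiableAt ℝ u x}) \ {x | fderiv ℝ u x = 0}) ((hs.inter hd).diff hc)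
    (fun x hx => hx.1.2.hasFDerivAt) fun x hx => hx.2
  refine (((h₁.add h₂).const_mul
    (volume (Metric.ball (0 : EuclideanSpace ℝ (Fin m)) 1) / 2 ^ m)).add h₃).mono (fun t => ?_) ?_
  · rw [mul_add]
    refine le_trans ?_ ((measure_union_le _ _).trans
      (add_le_add_left (measure_union_le (μ := stdHausdorff m _) _ _) _))
    refine measure_mono fun x hx => ?_
    by_cases hxd : DifferentiableAt ℝ u x <;> by_cases hxc : fderiv ℝ u x = 0 <;>
      simp_all
  · simp only [add_zero, mul_zero, zero_add]
    exact lintegral_mono_set (Set.sdiff_subset.trans Set.inter_subset_left)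

/-- The inequality `≤` in the coarea formula. -/
theorem LipschitzWith.upperLIntegralLE_setLIntegral_fiber (hu : LipschitzWith K u)
    {f : EuclideanSpace ℝ (Fin (m + 1)) → ENNReal} (hf : Measurable f) :
    UpperLIntegralLE (fun t => ∫⁻ x in u ⁻¹' {t}, f x ∂stdHausdorff m _)
      (∫⁻ x, f x * ENNReal.ofReal ‖fderiv ℝ u x‖) := by
  have hD : Measurable fun x => ENNReal.ofReal ‖fderiv ℝ u x‖ :=
    (measurable_fderiv ℝ u).norm.ennreal_ofReal
  refine Measurable.ennreal_induction (fun c s hs => ?_) (fun f g _ hf hg ihf ihg => ?_)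
    (fun f hf hmono ih => ?_) hf
  · refine ((hu.upperLIntegralLE_fiber hs).const_mul c).mono (fun t => ?_) ?_
    · rw [lintegral_indicator_const hs, Measure.restrict_apply hs]
    · rw [← lintegral_const_mul c hD, ← lintegral_indicator hs]
      simp_rw [Set.indicator_mul_left]
      rfl
  · refine (ihf.add ihg).mono (fun t => ?_) ?_
    · exact (lintegral_add_left hf _).le
    · simp only [Pi.add_apply, add_mul]
      exact (lintegral_add_left (hf.mul hD) _).ge
  · refine (UpperLIntegralLE.of_le_liminf ih fun t => ?_).mono (fun t => le_rfl) ?_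
    · rw [lintegral_iSup hf hmono]
      refine (tendsto_atTop_iSup fun i j hij => ?_).liminf_eq.ge
      exact lintegral_mono (hmono hij)
    · simp only [ENNReal.iSup_mul]
      refine le_of_le_of_eq ?_ (lintegral_iSup (fun i => (hf i).mul hD)
        fun i j hij x => mul_le_mul_left (hmono hij x) _).symm
      refine (tendsto_atTop_iSup fun i j hij => ?_).liminf_eq.le
      exact lintegral_mono fun x => mul_le_mul_left (hmono hij x) _

end Coarea

/-- Coarea-type inequality: if `ρ ≥ 0` is Borel and `∫_{Q ∩ u⁻¹(t)} ρ dH^{n-1} ≥ 1` for almost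
every `t ∈ (0,1)`, where `u` is Lipschitz, then `∫_Q ρ ‖∇u‖ dHⁿ ≥ 1`. The gradient is
represented by the Fréchet derivative `fderiv ℝ u`, which exists `Hⁿ`-a.e. by Rademacher's
theorem (and is junk elsewhere). -/
theorem lintegral_mul_gradient_ge_one (n : ℕ) (hn : 1 ≤ n)
    (Q : Set (EuclideanSpace ℝ (Fin n))) (hQ : IsCompact Q)
    (u : EuclideanSpace ℝ (Fin n) → ℝ) (K : NNReal) (hu : LipschitzWith K u)
    (ρ : EuclideanSpace ℝ (Fin n) → ℝ) (hρmeas : Measurable ρ) (hρpos : ∀ x, 0 ≤ ρ x)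
    (hadm : ∀ᵐ t ∂(volume.restrict (Set.Ioo (0 : ℝ) 1)),
      1 ≤ ∫⁻ x in Q ∩ u ⁻¹' {t}, ENNReal.ofReal (ρ x) ∂(stdHausdorff (n - 1) _)) :
    1 ≤ ∫⁻ x in Q,
          ENNReal.ofReal (ρ x) * ENNReal.ofReal ‖fderiv ℝ u x‖ ∂(stdHausdorff n _) := by
  obtain ⟨m, rfl⟩ := Nat.exists_eq_add_of_le' hn
  rw [Nat.add_sub_cancel] at hadm
  have hQm := hQ.measurableSet
  obtain ⟨G, hG, hfG, hGB⟩ :=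
    hu.upperLIntegralLE_setLIntegral_fiber (hρmeas.ennreal_ofReal.indicator hQm)
  calc (1 : ENNReal) = ∫⁻ _ in Set.Ioo (0 : ℝ) 1, 1 := by simp
    _ ≤ ∫⁻ t in Set.Ioo (0 : ℝ) 1, G t := by
      refine lintegral_mono_ae (hadm.mono fun t ht => ht.trans ((hfG t).trans' ?_))
      beta_reduce
      rw [lintegral_indicator hQm, Measure.restrict_restrict hQm]
    _ ≤ ∫⁻ t, G t := setLIntegral_le_lintegral _ _
    _ ≤ _ := hGB
    _ = ∫⁻ x in Q, ENNReal.ofReal (ρ x) * ENNReal.ofReal ‖fderiv ℝ u x‖ := by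
      rw [← lintegral_indicator hQm]
      simp_rw [Set.indicator_mul_left]
    _ ≤ _ := lintegral_mono' (Measure.restrict_mono le_rfl (volume_le_stdHausdorff _)) le_rfl
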